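/- arXiv:1309.1658 — 3 statements merged into one kernel-verified Lean document; each statement's English description precedes it below -/
import Mathlib

section
/- Let (A, 𝔪) be a Noetherian local ring, let Â denote its 𝔪-adic completion, and let x ∈ A. If I ⊆ J are ideals of A whose extensions to the localization A[1/x] (localization of A away from x) coincide, then the extensions of I and J to Â[1/x] (localization of Â away from the image of x) coincide. (In the paper this is applied with x the image of the prime number p.) -/
/-- Ideals with the same extension to `R[1/x]` have the same extension along every ring map
that sends `x` to a unit. -/
theorem Ideal.map_eq_map_of_map_away_eq {R S : Type*} [CommRing R] [CommRing S] {x : R}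
    {I J : Ideal R} (h : I.map (algebraMap R (Localization.Away x)) =
      J.map (algebraMap R (Localization.Away x))) (g : R →+* S) (hg : IsUnit (g x)) :
    I.map g = J.map g := by
  rw [← IsLocalization.Away.lift_comp (S := Localization.Away x) x hg, ← Ideal.map_map,
    ← Ideal.map_map, h]

/-- Let `(A, 𝔪)` be a Noetherian local ring, `Â` its `𝔪`-adic completion,
and `x ∈ A`.  If `I ⊆ J` are ideals of `A` whose extensions to the localization `A[1/x]`
coincide, then the extensions of `I` and `J` to `Â[1/x]` coincide. -/
theorem map_adicCompletion_away_eq_of_map_away_eq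
    {A : Type*} [CommRing A] [IsNoetherianRing A] [IsLocalRing A] (x : A)
    (I J : Ideal A) (hIJ : I ≤ J)
    (h : I.map (algebraMap A (Localization.Away x)) =
      J.map (algebraMap A (Localization.Away x))) :
    I.map ((algebraMap (AdicCompletion (IsLocalRing.maximalIdeal A) A)
          (Localization.Away
            (algebraMap A (AdicCompletion (IsLocalRing.maximalIdeal A) A) x))).comp
        (algebraMap A (AdicCompletion (IsLocalRing.maximalIdeal A) A))) =
    J.map ((algebraMap (AdicCompletion (IsLocalRing.maximalIdeal A) A)
          (Localization.Away
            (algebraMap A (AdicCompletion (IsLocalRing.maximalIdeal A) A) x))).comp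
        (algebraMap A (AdicCompletion (IsLocalRing.maximalIdeal A) A))) := by
  refine Ideal.map_eq_map_of_map_away_eq h _ ?_
  rw [RingHom.comp_apply]
  exact IsLocalization.Away.algebraMap_isUnit
    (algebraMap A (AdicCompletion (IsLocalRing.maximalIdeal A) A) x)
end

section
/- Let k be a field and k' a finite field extension of k. Then k' ⊗_k k((b)) is a field (in particular it is a reduced ring), where k((b)) denotes the field of formal Laurent series over k, regarded as a k-algebra via the constant-series embedding. -/
noncomputable section

open scoped TensorProduct

/- Shortcut instances: the canonical `k`-algebra structure on the field `k((b))` of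
formal Laurent series (via the constant-series embedding), registered with high priority
to keep instance search tractable. -/

noncomputable instance (priority := 10000) laurentSeriesAlgebra
    (k : Type*) [Field k] : Algebra k (LaurentSeries k) := inferInstance

noncomputable instance (priority := 10000) laurentSeriesModule
    (k : Type*) [Field k] : Module k (LaurentSeries k) := Algebra.toModule

/-- If a finite extension `k'` and a field extension `L` of `k` embed into a domain `M`,
compatibly over `k` and in such a way that `k`-linearly independent families of `k'` become
`L`-linearly independent, then `k' ⊗[k] L` is a field. -/
theorem isField_tensorProduct_of_linearIndependent {k k' L M : Type*} [Field k] [Field k']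
    [Field L] [CommRing M] [IsDomain M] [Algebra k k'] [Algebra k L] [FiniteDimensional k k']
    (f : k' →+* M) (g : L →+* M) (hfg : ∀ c, f (algebraMap k k' c) = g (algebraMap k L c))
    (h : ∀ {n : ℕ} (b : Fin n → k') (c : Fin n → L), LinearIndependent k b →
      ∑ i, f (b i) * g (c i) = 0 → c = 0) :
    IsField (k' ⊗[k] L) := by
  let : Algebra k M := (f.comp (algebraMap k k')).toAlgebra
  let φ : L ⊗[k] k' →ₐ[k] M := Algebra.TensorProduct.productMap
    { g with commutes' := fun c ↦ (hfg c).symm } { f with commutes' := fun c ↦ rfl }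
  have hφ (x : L) (a : k') : φ (x ⊗ₜ a) = g x * f a :=
    Algebra.TensorProduct.productMap_apply_tmul ..
  have inj : Function.Injective φ := by
    rw [injective_iff_map_eq_zero]
    intro z hz
    let B := Module.finBasis k k'
    obtain ⟨c, rfl⟩ := TensorProduct.eq_repr_basis_right B z
    suffices (c : _ → L) = 0 by simp [DFunLike.coe_fn_eq.1 (this.trans Finsupp.coe_zero.symm)]
    refine h B c B.linearIndependent ?_
    rw [map_finsuppSum, Finsupp.sum_fintype _ _ (by simp)] at hz
    simpa only [hφ, mul_comm] using hz
  have : IsDomain (L ⊗[k] k') := inj.isDomain φ.toRingHom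
  have : IsField (L ⊗[k] k') := isField_of_isIntegral_of_isField' (Field.toIsField L)
  exact (Algebra.TensorProduct.comm k k' L).toMulEquiv.isField this

/-- Applying a ring homomorphism to the coefficients of Hahn series, as a ring homomorphism. -/
def HahnSeries.mapRingHom {Γ R S : Type*} [AddCommMonoid Γ] [PartialOrder Γ]
    [IsOrderedCancelAddMonoid Γ] [Semiring R] [Semiring S] (f : R →+* S) :
    HahnSeries Γ R →+* HahnSeries Γ S where
  toFun x := x.map f
  map_one' := HahnSeries.map_one f.toMonoidWithZeroHom
  map_mul' x y := by
    have hsupp (z : HahnSeries Γ R) : (z.map f).support ⊆ z.support := fun g hg h ↦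
      hg (by simp [h])
    ext g
    simp only [HahnSeries.map_coeff, HahnSeries.coeff_mul, map_sum, map_mul]
    symm
    refine Finset.sum_subset (fun p hp ↦ ?_) fun p hp hp' ↦ ?_
    · rw [Finset.mem_antidiagonal] at hp ⊢
      exact ⟨hsupp x hp.1, hsupp y hp.2.1, hp.2.2⟩
    · rw [Finset.mem_antidiagonal] at hp
      by_contra h
      exact hp' (Finset.mem_antidiagonal.2
        ⟨left_ne_zero_of_mul h, right_ne_zero_of_mul h, hp.2.2⟩)
  map_zero' := by ext; simp
  map_add' x y := by ext; simp

theorem algebraMap_laurentSeries (k : Type*) [Field k] (c : k) :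
    algebraMap k (LaurentSeries k) c = HahnSeries.C c := by
  simp [RingHom.algebraMap_toAlgebra]

/-- Let `k` be a field and `k'` a finite field extension of `k`.  Then
`k' ⊗_k k((b))` is a field, in particular a reduced ring, where `k((b))` denotes the
field of formal Laurent series over `k`, regarded as a `k`-algebra via the
constant-series embedding. -/
theorem isField_tensor_laurentSeries
    (k k' : Type*) [Field k] [Field k'] [Algebra k k'] [FiniteDimensional k k'] :
    IsField (k' ⊗[k] LaurentSeries k) ∧ IsReduced (k' ⊗[k] LaurentSeries k) := by
  have hfield : IsField (k' ⊗[k] LaurentSeries k) := by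
    refine isField_tensorProduct_of_linearIndependent (M := LaurentSeries k') HahnSeries.C
      (HahnSeries.mapRingHom (algebraMap k k')) (fun c ↦ ?_) fun b c hb hsum ↦ ?_
    · rw [algebraMap_laurentSeries]
      exact (HahnSeries.map_single (Γ := ℤ) (a := 0) (r := c)
        ((algebraMap k k').toMonoidWithZeroHom : ZeroHom k k')).symm
    · ext i n
      refine Fintype.linearIndependent_iff.1 hb (fun i ↦ (c i).coeff n) ?_ i
      rw [← HahnSeries.coeff_zero (Γ := ℤ) (R := k') (a := n), ← hsum, HahnSeries.coeff_sum]
      refine Finset.sum_congr rfl fun i _ ↦ ?_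
      rw [HahnSeries.C_mul_eq_smul, HahnSeries.coeff_smul, Algebra.smul_def, mul_comm]
      rfl
  let := hfield.toField
  exact ⟨hfield, inferInstance⟩
end
end

section
/- Let 𝔽 be a field, let k be the fraction field of the formal power series ring 𝔽⟦X⟧, and let L be the fraction field of the two-variable formal power series ring 𝔽⟦X,Y⟧, regarded as a field extension of k via the inclusion 𝔽⟦X⟧ ↪ 𝔽⟦X,Y⟧. Then L is geometrically reduced over k: for every finite field extension k' of k, the ring k' ⊗_k L is reduced. -/
noncomputable section

open scoped TensorProduct

/-- Coefficientwise extension of scalars of Hahn series, as an algebra homomorphism. -/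
def HahnSeries.mapAlgebraMap (Γ R S : Type*) [AddCommMonoid Γ] [PartialOrder Γ]
    [IsOrderedCancelAddMonoid Γ] [CommSemiring R] [CommSemiring S] [Algebra R S] :
    HahnSeries Γ R →ₐ[R] HahnSeries Γ S where
  toFun x := x.map (algebraMap R S)
  map_one' := HahnSeries.map_one (algebraMap R S).toMonoidWithZeroHom
  map_mul' x y := HahnSeries.map_mul (algebraMap R S : R →ₙ+* S) (x := x) (y := y)
  map_zero' := HahnSeries.map_zero (algebraMap R S : ZeroHom R S)
  map_add' x y := HahnSeries.map_add (algebraMap R S : R →+ S) (x := x) (y := y)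
  commutes' r := by
    ext n
    by_cases h : n = 0 <;> simp [HahnSeries.algebraMap_apply, HahnSeries.C_apply, h]

@[simp]
theorem HahnSeries.coeff_mapAlgebraMap {Γ R S : Type*} [AddCommMonoid Γ] [PartialOrder Γ]
    [IsOrderedCancelAddMonoid Γ] [CommSemiring R] [CommSemiring S] [Algebra R S]
    (x : HahnSeries Γ R) (n : Γ) :
    (HahnSeries.mapAlgebraMap Γ R S x).coeff n = algebraMap R S (x.coeff n) := rfl

/-- A field extension of `k` that embeds into a Hahn series field over `k` becomes a domain after
any extension of the base field. -/
theorem isDomain_tensorProduct_of_ringHom_hahnSeries {Γ k L k' : Type*} [AddCommGroup Γ]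
    [LinearOrder Γ] [IsOrderedAddMonoid Γ] [Field k] [Field L] [Algebra k L] [Field k']
    [Algebra k k'] (f : L →+* HahnSeries Γ k)
    (hf : f.comp (algebraMap k L) = HahnSeries.C) : IsDomain (k' ⊗[k] L) := by
  classical
  let f' : L →ₐ[k] HahnSeries Γ k := AlgHom.mk f (RingHom.congr_fun hf)
  let b := Module.Basis.ofVectorSpace k k'
  let φ : k' ⊗[k] L →ₐ[k] HahnSeries Γ k' :=
    Algebra.TensorProduct.lift (IsScalarTower.toAlgHom k k' (HahnSeries Γ k'))
      ((HahnSeries.mapAlgebraMap Γ k k').comp f') fun _ _ => Commute.all _ _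
  have hφ : Function.Injective φ := by
    rw [injective_iff_map_eq_zero]
    intro z hz
    obtain ⟨l, rfl⟩ := (TensorProduct.equivFinsuppOfBasisLeft (N := L) b).symm.surjective z
    rw [TensorProduct.equivFinsuppOfBasisLeft_symm_apply] at hz
    suffices l = 0 by simp [this]
    ext i
    apply f.injective
    ext n
    have hn : l.sum (fun i x => (f x).coeff n • b i) = 0 := by
      have := congrArg (fun s => HahnSeries.coeff s n) hz
      simpa [φ, f', Finsupp.sum, HahnSeries.coeff_sum, HahnSeries.algebraMap_apply,
        HahnSeries.C_mul_eq_smul, Algebra.smul_def, mul_comm] using this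
    by_cases hi : i ∈ l.support
    · simpa using linearIndependent_iff'.mp b.linearIndependent _ _ hn i hi
    · simp [Finsupp.notMem_support_iff.mp hi]
  exact hφ.isDomain φ.toRingHom

theorem IsFractionRing.lift_comp_algebraMap_eq {A B k L K : Type*} [CommRing A] [CommRing B]
    [IsDomain A] [IsDomain B] [Field k] [Field L] [Field K] [Algebra A B] [Algebra A k]
    [IsFractionRing A k] [Algebra B L] [IsFractionRing B L] [Algebra k L] [Algebra A L]
    [IsScalarTower A k L] [IsScalarTower A B L] {g : B →+* K} (hg : Function.Injective g)
    (c : k →+* K) (hgc : ∀ a : A, g (algebraMap A B a) = c (algebraMap A k a)) :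
    (IsFractionRing.lift hg : L →+* K).comp (algebraMap k L) = c :=
  IsFractionRing.ringHom_ext (A := A) fun a => by
    rw [RingHom.comp_apply, ← IsScalarTower.algebraMap_apply A k L,
      IsScalarTower.algebraMap_apply A B L, IsFractionRing.lift_algebraMap, hgc]

/-- The ring homomorphism `R⟦X⟧⟦Y⟧ → R⟦X⟧⟦Y⟧` exchanging the two variables. -/
def PowerSeries.swap (R : Type*) [CommSemiring R] :
    PowerSeries (PowerSeries R) →+* PowerSeries (PowerSeries R) where
  toFun f := .mk fun m => .mk fun n => coeff m (coeff n f)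
  map_one' := by
    ext m n
    by_cases hm : m = 0 <;> by_cases hn : n = 0 <;> simp [coeff_one, hm, hn]
  map_mul' f g := by
    ext m n
    simp only [coeff_mk, coeff_mul, map_sum]
    exact Finset.sum_comm
  map_zero' := by ext; simp
  map_add' f g := by ext; simp

theorem PowerSeries.coeff_coeff_swap {R : Type*} [CommSemiring R]
    (f : PowerSeries (PowerSeries R)) (m n : ℕ) :
    coeff n (coeff m (swap R f)) = coeff m (coeff n f) := by
  simp [swap]

theorem PowerSeries.swap_injective (R : Type*) [CommSemiring R] :
    Function.Injective (swap R) := by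
  intro f g h
  ext m n
  rw [← coeff_coeff_swap, h, coeff_coeff_swap]

theorem PowerSeries.swap_map_C {R : Type*} [CommSemiring R] (a : PowerSeries R) :
    swap R (map C a) = C a := by
  ext m n
  rw [coeff_coeff_swap, coeff_map, coeff_C, coeff_C]
  split_ifs <;> simp

/-- The embedding of `R⟦X⟧⟦Y⟧` into `k⸨X⸩`, where `k` is an extension of `R⟦Y⟧`. -/
def PowerSeries.swapToHahnSeries (R k : Type*) [CommRing R] [Field k]
    [Algebra (PowerSeries R) k] : PowerSeries (PowerSeries R) →+* HahnSeries ℤ k :=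
  (HahnSeries.ofPowerSeries ℤ k).comp ((map (algebraMap (PowerSeries R) k)).comp (swap R))

theorem PowerSeries.swapToHahnSeries_injective (R k : Type*) [CommRing R] [IsDomain R] [Field k]
    [Algebra (PowerSeries R) k] [IsFractionRing (PowerSeries R) k] :
    Function.Injective (swapToHahnSeries R k) := by
  simp only [swapToHahnSeries, RingHom.coe_comp]
  exact Function.Injective.comp HahnSeries.ofPowerSeries_injective
    (Function.Injective.comp
      (map_injective _ (IsFractionRing.injective (PowerSeries R) k)) (swap_injective R))

theorem PowerSeries.swapToHahnSeries_algebraMap {R k : Type*} [CommRing R] [Field k]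
    [Algebra (PowerSeries R) k] (a : PowerSeries R) :
    swapToHahnSeries R k (algebraMap (PowerSeries R) (PowerSeries (PowerSeries R)) a) =
      HahnSeries.C (algebraMap (PowerSeries R) k a) := by
  have h : algebraMap (PowerSeries R) (PowerSeries (PowerSeries R)) a = map C a := rfl
  rw [h, swapToHahnSeries, RingHom.comp_apply, RingHom.comp_apply, swap_map_C, map_C,
    HahnSeries.ofPowerSeries_C]

/- `𝔽` is a field.  We realize `𝔽⟦X,Y⟧` as `(𝔽⟦X⟧)⟦Y⟧ = PowerSeries (PowerSeries 𝔽)`,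
with the inclusion `𝔽⟦X⟧ → 𝔽⟦X,Y⟧` (sending `X` to `X`) given by the constant-series
(algebra) map `PowerSeries 𝔽 → PowerSeries (PowerSeries 𝔽)`.  `k` is a fraction field of
`𝔽⟦X⟧` and `L` a fraction field of `𝔽⟦X,Y⟧`; the requirement that the `k`-algebra
structure of `L` be the one induced by this inclusion is expressed by the two scalar
tower hypotheses. -/

/-- Let `k = Frac(𝔽⟦X⟧)` and `L = Frac(𝔽⟦X,Y⟧)`, viewed as a field
extension of `k` via the inclusion `𝔽⟦X⟧ ↪ 𝔽⟦X,Y⟧`.  Then `L` is geometrically reduced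
over `k`: for every finite field extension `k'` of `k`, the ring `k' ⊗_k L` is
reduced. -/
theorem isReduced_tensor_fractionRing_powerSeries
    (𝔽 : Type*) [Field 𝔽]
    (k L : Type*) [Field k] [Field L]
    [Algebra (PowerSeries 𝔽) k] [IsFractionRing (PowerSeries 𝔽) k]
    [Algebra (PowerSeries (PowerSeries 𝔽)) L]
    [IsFractionRing (PowerSeries (PowerSeries 𝔽)) L]
    [Algebra k L] [Algebra (PowerSeries 𝔽) L]
    [IsScalarTower (PowerSeries 𝔽) k L]
    [IsScalarTower (PowerSeries 𝔽) (PowerSeries (PowerSeries 𝔽)) L]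
    (k' : Type*) [Field k'] [Algebra k k'] [FiniteDimensional k k'] :
    IsReduced (k' ⊗[k] L) := by
  have := isDomain_tensorProduct_of_ringHom_hahnSeries (k' := k') _
    (IsFractionRing.lift_comp_algebraMap_eq (L := L) (PowerSeries.swapToHahnSeries_injective 𝔽 k)
      HahnSeries.C PowerSeries.swapToHahnSeries_algebraMap)
  infer_instance
end
end
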